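/- arXiv:2202.08581 — 12 statements merged into one kernel-verified Lean document; each statement's English description precedes it below -/
import Mathlib

section
/- For every classical one-bit strategy for the partial ignorance communication task T_{3,1}, i.e., every pair of functions r : Fin 3 → Bool (Alice's encoding) and g : Fin 3 → Bool → Fin 3 (Bob's guessing), the number of ordered pairs (s, a) ∈ Fin 3 × Fin 3 with s ≠ a for which g(b, r(a)) = s — where b denotes the unique element of Fin 3 distinct from both s and a — is at most 5 out of the 6 possible pairs. Equivalently, the average classical success probability for T_{3,1} with one bit of communication is at most 5/6. -/
/-- For every classical one-bit strategy for the partial ignorance communication task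
`T_{3,1}` (encoding `r : Fin 3 → Bool`, guessing `g : Fin 3 → Bool → Fin 3`), the number of
ordered pairs `(s, a)` with `s ≠ a` on which Bob's guess `g b (r a)` (where `b` is the unique
element of `Fin 3` distinct from both `s` and `a`) equals `s` is at most `5` out of `6`. -/
theorem T31_classical_bit_upper_bound (r : Fin 3 → Bool) (g : Fin 3 → Bool → Fin 3) :
    (Finset.univ.filter fun p : Fin 3 × Fin 3 =>
        p.1 ≠ p.2 ∧ ∀ b : Fin 3, b ≠ p.1 → b ≠ p.2 → g b (r p.2) = p.1).card ≤ 5 := by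
  obtain ⟨a, a', hne, hr⟩ := Fintype.exists_ne_map_eq_of_card_lt r (by simp)
  obtain ⟨b, hba, hba'⟩ : ∃ b : Fin 3, b ≠ a ∧ b ≠ a' := by
    clear hne hr
    decide +revert
  have hss : (Finset.univ.filter fun p : Fin 3 × Fin 3 =>
      p.1 ≠ p.2 ∧ ∀ b : Fin 3, b ≠ p.1 → b ≠ p.2 → g b (r p.2) = p.1) ⊂
      (Finset.univ : Finset (Fin 3)).offDiag := by
    refine (Finset.ssubset_iff_of_subset fun p hp => ?_).2 ?_
    · simpa using (Finset.mem_filter.1 hp).2.1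
    · by_contra! h
      have h₁ := (Finset.mem_filter.1 (h (a, a') (by simpa using hne))).2.2 b hba hba'
      have h₂ := (Finset.mem_filter.1 (h (a', a) (by simpa using hne.symm))).2.2 b hba' hba
      simp only [hr] at h₁ h₂
      exact hne (h₁.symm.trans h₂)
  have hcard := Finset.card_lt_card hss
  rw [Finset.offDiag_card, Finset.card_univ, Fintype.card_fin] at hcard
  omega
end

section
/- For every classical one-bit strategy for the partial ignorance communication task T_{4,1}, i.e., every pair of functions r : Fin 4 → Bool (Alice's encoding) and g : P → Bool → Fin 4 (Bob's guessing), where P is the set of 2-element subsets of Fin 4, the number of ordered pairs (s, a) ∈ Fin 4 × Fin 4 with s ≠ a for which g(b, r(a)) = s — where b is the 2-element set Fin 4 \ {s, a} — is at most 10 out of the 12 possible pairs. Equivalently, the average classical success probability for T_{4,1} with one bit of communication is at most 10/12 = 5/6. -/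
/-- Bob cannot tell `(x, y)` from `(y, x)` when Alice sends the same bit for both, so he fails on
at least one of them. -/
theorem exists_guess_ne_of_encoding_eq (r : Fin 4 → Bool)
    (g : {t : Finset (Fin 4) // t.card = 2} → Bool → Fin 4) {x y : Fin 4} (hxy : x ≠ y)
    (hr : r x = r y) :
    ∃ p : Fin 4 × Fin 4, s(p.1, p.2) = s(x, y) ∧
      ¬ ∀ b : {t : Finset (Fin 4) // t.card = 2},
        (b : Finset (Fin 4)) = ({p.1, p.2} : Finset (Fin 4))ᶜ → g b (r p.2) = p.1 := by
  by_contra! H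
  have hcard : (({x, y} : Finset (Fin 4))ᶜ).card = 2 := by
    rw [Finset.card_compl, Finset.card_pair hxy, Fintype.card_fin]
  have h₁ := H (x, y) rfl ⟨_, hcard⟩ rfl
  have h₂ := H (y, x) Sym2.eq_swap ⟨_, hcard⟩ (congrArg compl (Finset.pair_comm x y))
  exact hxy (h₁.symm.trans (hr ▸ h₂))

/-- Every two-colouring of four points has at least two monochromatic pairs. -/
theorem exists_two_monochromatic_pairs (r : Fin 4 → Bool) :
    ∃ x y z w : Fin 4, x ≠ y ∧ r x = r y ∧ z ≠ w ∧ r z = r w ∧ s(x, y) ≠ s(z, w) := by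
  revert r
  decide

/-- For every classical one-bit strategy for the task `T_{4,1}` (encoding `r : Fin 4 → Bool`,
guessing `g : P → Bool → Fin 4` where `P` is the set of 2-element subsets of `Fin 4`), the
number of ordered pairs `(s, a)` with `s ≠ a` on which Bob's guess `g b (r a)` — where
`b = Fin 4 \ {s, a}` is the 2-element set revealed to Bob — equals `s` is at most `10` out
of `12`. -/
theorem T41_classical_bit_upper_bound (r : Fin 4 → Bool)
    (g : {t : Finset (Fin 4) // t.card = 2} → Bool → Fin 4) :
    (Finset.univ.filter fun p : Fin 4 × Fin 4 =>
        p.1 ≠ p.2 ∧ ∀ b : {t : Finset (Fin 4) // t.card = 2},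
          (b : Finset (Fin 4)) = ({p.1, p.2} : Finset (Fin 4))ᶜ → g b (r p.2) = p.1).card
      ≤ 10 := by
  obtain ⟨x, y, z, w, hxy, hrxy, hzw, hrzw, hne⟩ := exists_two_monochromatic_pairs r
  obtain ⟨p, hp, hpS⟩ := exists_guess_ne_of_encoding_eq r g hxy hrxy
  obtain ⟨q, hq, hqS⟩ := exists_guess_ne_of_encoding_eq r g hzw hrzw
  have hpq : p ≠ q := by
    rintro rfl
    exact hne (hp.symm.trans hq)
  have hp_ne : p.1 ≠ p.2 := by
    rwa [Ne, ← Sym2.mk_isDiag_iff, hp, Sym2.mk_isDiag_iff]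
  have hq_ne : q.1 ≠ q.2 := by
    rwa [Ne, ← Sym2.mk_isDiag_iff, hq, Sym2.mk_isDiag_iff]
  have hsub : ({p, q} : Finset (Fin 4 × Fin 4)) ⊆ Finset.univ.offDiag := by
    simp [Finset.insert_subset_iff, hp_ne, hq_ne]
  calc
    _ ≤ (Finset.univ.offDiag \ {p, q}).card := by
      refine Finset.card_le_card fun t ht => ?_
      obtain ⟨ht_ne, htS⟩ := (Finset.mem_filter.mp ht).2
      simp only [Finset.mem_sdiff, Finset.mem_offDiag, Finset.mem_univ, true_and,
        Finset.mem_insert, Finset.mem_singleton]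
      refine ⟨ht_ne, ?_⟩
      rintro (rfl | rfl)
      · exact hpS htS
      · exact hqS htS
    _ = 10 := by
      rw [Finset.card_sdiff_of_subset hsub, Finset.card_pair hpq, Finset.offDiag_card]
      simp
end

section
/- For every classical one-bit strategy for the partial ignorance communication task T_{4,2}, i.e., every pair of functions r : P → Bool (Alice's encoding, where P is the set of 2-element subsets of Fin 4) and g : Fin 4 → Bool → Fin 4 (Bob's guessing), the number of pairs (s, a) — where s ∈ Fin 4 and a is a 2-element subset of Fin 4 with s ∉ a — for which g(b, r(a)) = s, where b is the unique element of Fin 4 \ ({s} ∪ a), is at most 8 out of the 12 possible pairs. Equivalently, the average classical success probability for T_{4,2} with one bit of communication is at most 2/3. -/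
theorem exists_eq_compl_pair_of_card_eq_two (s : Fin 4) (a : Finset (Fin 4)) (ha : a.card = 2)
    (hs : s ∉ a) : ∃ b, b ∉ insert s a ∧ a = {s, b}ᶜ := by
  revert s a
  decide


/-- For every classical one-bit strategy for the task `T_{4,2}` (encoding `r : P → Bool`
where `P` is the set of 2-element subsets of `Fin 4`, guessing `g : Fin 4 → Bool → Fin 4`),
the number of pairs `(s, a)` with `s ∉ a` on which Bob's guess `g b (r a)` — where `b` is
the unique element of `Fin 4 \ ({s} ∪ a)` — equals `s` is at most `8` out of `12`. -/
theorem T42_classical_bit_upper_bound (r : {t : Finset (Fin 4) // t.card = 2} → Bool)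
    (g : Fin 4 → Bool → Fin 4) :
    (Finset.univ.filter fun p : Fin 4 × {t : Finset (Fin 4) // t.card = 2} =>
        p.1 ∉ (p.2 : Finset (Fin 4)) ∧
          ∀ b : Fin 4, b ∉ insert p.1 (p.2 : Finset (Fin 4)) → g b (r p.2) = p.1).card
      ≤ 8 := by
  classical
  let guessed : Fin 4 × Bool → Fin 4 × Finset (Fin 4) := fun q => (g q.1 q.2, {g q.1 q.2, q.1}ᶜ)
  let forget : Fin 4 × {t : Finset (Fin 4) // t.card = 2} → Fin 4 × Finset (Fin 4) :=
    Prod.map id Subtype.val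
  have forget_injective : Function.Injective forget :=
    Function.injective_id.prodMap Subtype.val_injective
  rw [← Finset.card_image_of_injective _ forget_injective]
  calc
    _ ≤ (Finset.univ.image guessed).card := by
      refine Finset.card_le_card fun x hx => ?_
      obtain ⟨⟨s, a, ha⟩, hp, rfl⟩ := Finset.mem_image.mp hx
      obtain ⟨hs, hg⟩ := (Finset.mem_filter.mp hp).2
      obtain ⟨b, hb, hab⟩ := exists_eq_compl_pair_of_card_eq_two s a ha hs
      have hgb : g b (r ⟨a, ha⟩) = s := hg b hb
      exact Finset.mem_image.mpr
        ⟨(b, r ⟨a, ha⟩), Finset.mem_univ _, Prod.ext hgb (by simp [guessed, forget, hgb, ← hab])⟩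
    _ ≤ (Finset.univ : Finset (Fin 4 × Bool)).card := Finset.card_image_le
    _ = 8 := by simp
end

section
/- For any three unit vectors φ₁, φ₂, φ₃ ∈ ℂ² and any three binary POVMs M₁, M₂, M₃ on ℂ² (each consisting of two 2×2 positive semidefinite matrices M_k(1), M_k(2) with M_k(1) + M_k(2) = I), the sum over k ∈ {1,2,3} of tr(|φ_i⟩⟨φ_i| M_k(1)) + tr(|φ_j⟩⟨φ_j| M_k(2)) — where for each k, i < j are the two indices in {1,2,3} different from k — is at most 3(1 + √3/2) = 3 + (3√3)/2. Hence the average success probability of any pure-state qubit strategy for T_{3,1} is at most (1/2)(1 + √3/2). -/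
open Matrix ComplexOrder

/-- Half the Bloch vector of the pure qubit state `v`. -/
noncomputable def halfBloch (v : Fin 2 → ℂ) : Fin 3 → ℝ :=
  ![(Complex.normSq (v 0) - Complex.normSq (v 1)) / 2,
    (v 0 * star (v 1)).re, (v 0 * star (v 1)).im]

/-- Half the Bloch vector of a qubit effect `E`, the scalar part `E.trace / 2` being left out. -/
noncomputable def effectBloch (E : Matrix (Fin 2) (Fin 2) ℂ) : Fin 3 → ℝ :=
  ![((E 0 0).re - (E 1 1).re) / 2, (E 1 0).re, -(E 1 0).im]

lemma normSq_add_normSq_of_unit {v : Fin 2 → ℂ} (hv : star v ⬝ᵥ v = 1) :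
    Complex.normSq (v 0) + Complex.normSq (v 1) = 1 := by
  have h := congrArg Complex.re hv
  simp [dotProduct, Fin.sum_univ_two] at h
  simp only [Complex.normSq_apply]
  linarith

lemma halfBloch_sq {v : Fin 2 → ℂ} (hv : star v ⬝ᵥ v = 1) :
    halfBloch v 0 ^ 2 + halfBloch v 1 ^ 2 + halfBloch v 2 ^ 2 = 1 / 4 := by
  have h := normSq_add_normSq_of_unit hv
  simp only [Complex.normSq_apply] at h
  simp [halfBloch, Complex.normSq_apply]
  linear_combination (((v 0).re * (v 0).re + (v 0).im * (v 0).im +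
    ((v 1).re * (v 1).re + (v 1).im * (v 1).im)) + 1) / 4 * h

lemma Matrix.IsHermitian.entries_fin_two {E : Matrix (Fin 2) (Fin 2) ℂ} (hE : E.IsHermitian) :
    (E 0 0).im = 0 ∧ (E 1 1).im = 0 ∧ (E 0 1).re = (E 1 0).re ∧ (E 0 1).im = -(E 1 0).im := by
  have h0 := congrArg Complex.im (hE.apply 0 0)
  have h1 := congrArg Complex.im (hE.apply 1 1)
  have h2 := congrArg Complex.re (hE.apply 0 1)
  have h3 := congrArg Complex.im (hE.apply 0 1)
  simp at h0 h1 h2 h3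
  refine ⟨?_, ?_, ?_, ?_⟩ <;> linarith

lemma trace_vecMulVec_mul_re {v : Fin 2 → ℂ} (hv : star v ⬝ᵥ v = 1)
    {E : Matrix (Fin 2) (Fin 2) ℂ} (hE : E.IsHermitian) :
    (trace (vecMulVec v (star v) * E)).re = ((E 0 0).re + (E 1 1).re) / 2 +
      2 * (halfBloch v 0 * effectBloch E 0 + halfBloch v 1 * effectBloch E 1 +
        halfBloch v 2 * effectBloch E 2) := by
  have h := normSq_add_normSq_of_unit hv
  obtain ⟨h0, h1, h2, h3⟩ := hE.entries_fin_two
  simp only [Complex.normSq_apply] at h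
  simp [trace, Fin.sum_univ_two, mul_apply, vecMulVec_apply, halfBloch, effectBloch,
    Complex.normSq_apply, h0, h1, h2, h3]
  linear_combination ((E 0 0).re + (E 1 1).re) / 2 * h

lemma Matrix.PosSemidef.effectBloch_sq_le {E : Matrix (Fin 2) (Fin 2) ℂ} (hE : E.PosSemidef) :
    0 ≤ (E 0 0).re + (E 1 1).re ∧
      effectBloch E 0 ^ 2 + effectBloch E 1 ^ 2 + effectBloch E 2 ^ 2 ≤
        (((E 0 0).re + (E 1 1).re) / 2) ^ 2 := by
  obtain ⟨h0, h1, h2, h3⟩ := hE.isHermitian.entries_fin_two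
  have ha := (Complex.le_def.1 (hE.diag_nonneg (i := 0))).1
  have hd := (Complex.le_def.1 (hE.diag_nonneg (i := 1))).1
  have hdet := (Complex.le_def.1 hE.det_nonneg).1
  simp [det_fin_two, h0, h1, h2, h3] at ha hd hdet
  refine ⟨add_nonneg ha hd, ?_⟩
  simp [effectBloch]
  nlinarith

lemma effectBloch_sq_le_quarter {E F : Matrix (Fin 2) (Fin 2) ℂ} (hE : E.PosSemidef)
    (hF : F.PosSemidef) (hEF : E + F = 1) :
    effectBloch E 0 ^ 2 + effectBloch E 1 ^ 2 + effectBloch E 2 ^ 2 ≤ 1 / 4 := by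
  obtain rfl : F = 1 - E := eq_sub_of_add_eq' hEF
  obtain ⟨hE0, hE1⟩ := hE.effectBloch_sq_le
  obtain ⟨hF0, hF1⟩ := hF.effectBloch_sq_le
  simp [effectBloch] at hE0 hE1 hF0 hF1 ⊢
  rcases le_total ((E 0 0).re + (E 1 1).re) 1 with h | h <;> nlinarith

/-- A quadratic relaxation of the Helstrom bound for two pure qubit states, tight when their
trace distance is `√3 / 2`. -/
lemma trace_add_trace_le {u v : Fin 2 → ℂ} (hu : star u ⬝ᵥ u = 1) (hv : star v ⬝ᵥ v = 1)
    {E F : Matrix (Fin 2) (Fin 2) ℂ} (hE : E.PosSemidef) (hF : F.PosSemidef)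
    (hEF : E + F = 1) :
    (trace (vecMulVec u (star u) * E)).re + (trace (vecMulVec v (star v) * F)).re ≤
      1 + √3 / 4 + √3 / 3 * ((halfBloch u 0 - halfBloch v 0) ^ 2 +
        (halfBloch u 1 - halfBloch v 1) ^ 2 + (halfBloch u 2 - halfBloch v 2) ^ 2) := by
  have hq := effectBloch_sq_le_quarter hE hF hEF
  rw [trace_vecMulVec_mul_re hu hE.isHermitian, trace_vecMulVec_mul_re hv hF.isHermitian]
  obtain rfl : F = 1 - E := eq_sub_of_add_eq' hEF
  have e0 : effectBloch (1 - E) 0 = -effectBloch E 0 := by simp [effectBloch]; ring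
  have e1 : effectBloch (1 - E) 1 = -effectBloch E 1 := by simp [effectBloch]
  have e2 : effectBloch (1 - E) 2 = -effectBloch E 2 := by simp [effectBloch]
  rw [e0, e1, e2]
  simp only [Matrix.sub_apply, one_apply_eq, Complex.sub_re, Complex.one_re]
  have hs : √3 * √3 = 3 := Real.mul_self_sqrt (by norm_num)
  have amgm (x y : ℝ) : 2 * (x * y) ≤ √3 / 3 * x ^ 2 + √3 * y ^ 2 := by
    have h : √3 / 3 * x ^ 2 + √3 * y ^ 2 - 2 * (x * y) = √3 / 3 * (x - √3 * y) ^ 2 := by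
      linear_combination (2 / 3 * x * y - √3 / 3 * y ^ 2) * hs
    have : 0 ≤ √3 / 3 * (x - √3 * y) ^ 2 := by positivity
    linarith
  have := mul_le_mul_of_nonneg_left hq (Real.sqrt_nonneg 3)
  linarith [amgm (halfBloch u 0 - halfBloch v 0) (effectBloch E 0),
    amgm (halfBloch u 1 - halfBloch v 1) (effectBloch E 1),
    amgm (halfBloch u 2 - halfBloch v 2) (effectBloch E 2)]

/-- For any three unit vectors `φ₀, φ₁, φ₂ ∈ ℂ²` and any three binary qubit POVMs
`M₀, M₁, M₂`, the `T_{3,1}` success metric — the sum over `k` of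
`tr(|φ_i⟩⟨φ_i| M_k(1)) + tr(|φ_j⟩⟨φ_j| M_k(2))`, where `i < j` are the two indices
different from `k` — is at most `3(1 + √3/2)`. Hence the average success probability of any
pure-state qubit strategy for `T_{3,1}` is at most `(1/2)(1 + √3/2)`. -/
theorem T31_qubit_upper_bound (φ : Fin 3 → Fin 2 → ℂ)
    (hφ : ∀ m, star (φ m) ⬝ᵥ φ m = 1)
    (M : Fin 3 → Fin 2 → Matrix (Fin 2) (Fin 2) ℂ)
    (hM : ∀ k o, (M k o).PosSemidef)
    (hMsum : ∀ k, M k 0 + M k 1 = 1) :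
    (Matrix.trace (Matrix.vecMulVec (φ 1) (star (φ 1)) * M 0 0)).re +
        (Matrix.trace (Matrix.vecMulVec (φ 2) (star (φ 2)) * M 0 1)).re +
        (Matrix.trace (Matrix.vecMulVec (φ 0) (star (φ 0)) * M 1 0)).re +
        (Matrix.trace (Matrix.vecMulVec (φ 2) (star (φ 2)) * M 1 1)).re +
        (Matrix.trace (Matrix.vecMulVec (φ 0) (star (φ 0)) * M 2 0)).re +
        (Matrix.trace (Matrix.vecMulVec (φ 1) (star (φ 1)) * M 2 1)).re
      ≤ 3 * (1 + Real.sqrt 3 / 2) := by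
  have h0 := trace_add_trace_le (hφ 1) (hφ 2) (hM 0 0) (hM 0 1) (hMsum 0)
  have h1 := trace_add_trace_le (hφ 0) (hφ 2) (hM 1 0) (hM 1 1) (hMsum 1)
  have h2 := trace_add_trace_le (hφ 0) (hφ 1) (hM 2 0) (hM 2 1) (hMsum 2)
  have b (i : Fin 3) := halfBloch_sq (hφ i)
  have hsum :
      (∑ k, (halfBloch (φ 1) k - halfBloch (φ 2) k) ^ 2) +
        (∑ k, (halfBloch (φ 0) k - halfBloch (φ 2) k) ^ 2) +
        (∑ k, (halfBloch (φ 0) k - halfBloch (φ 1) k) ^ 2) ≤ 9 / 4 := by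
    have sq (k : Fin 3) := sq_nonneg (halfBloch (φ 0) k + halfBloch (φ 1) k + halfBloch (φ 2) k)
    simp only [Fin.sum_univ_three]
    linarith [b 0, b 1, b 2, sq 0, sq 1, sq 2]
  have := mul_le_mul_of_nonneg_left hsum (by positivity : 0 ≤ √3 / 3)
  simp only [Fin.sum_univ_three] at this
  linarith
end

section
/- (Ambiguous discrimination bound for pure states) Let u, v be unit vectors in ℂ^d and let E be a d×d complex matrix with 0 ≤ E ≤ I (i.e., E and I − E are both positive semidefinite). Then tr(|u⟩⟨u| E) + tr(|v⟩⟨v| (I − E)) ≤ 1 + √(1 − |⟨u, v⟩|²). Consequently, for any binary POVM the probability of correctly distinguishing the two pure states |u⟩⟨u| and |v⟩⟨v| (each given with probability 1/2) is at most (1/2)(1 + √(1 − |⟨u, v⟩|²)). -/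
open Matrix ComplexOrder

open scoped MatrixOrder in
/-- The Cauchy–Schwarz inequality for the form defined by a positive semidefinite matrix. -/
theorem Matrix.PosSemidef.norm_dotProduct_mulVec_le {n : Type*} [Fintype n]
    {A : Matrix n n ℂ} (hA : A.PosSemidef) (x y : n → ℂ) :
    ‖star x ⬝ᵥ A *ᵥ y‖ ≤ √(star x ⬝ᵥ A *ᵥ x).re * √(star y ⬝ᵥ A *ᵥ y).re := by
  classical
  obtain ⟨B, rfl⟩ := CStarAlgebra.nonneg_iff_eq_star_mul_self.mp hA.nonneg
  rw [star_eq_conjTranspose]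
  have hB (x y : n → ℂ) : star x ⬝ᵥ (Bᴴ * B) *ᵥ y =
      inner ℂ (WithLp.toLp 2 (B *ᵥ x)) (WithLp.toLp 2 (B *ᵥ y)) := by
    rw [EuclideanSpace.inner_toLp_toLp, dotProduct_comm (B *ᵥ y), star_mulVec,
      ← mulVec_mulVec, dotProduct_mulVec]
  have hre (x : n → ℂ) :
      √(star x ⬝ᵥ (Bᴴ * B) *ᵥ x).re = ‖WithLp.toLp 2 (B *ᵥ x)‖ := by
    rw [hB]
    exact (norm_eq_sqrt_re_inner (𝕜 := ℂ) _).symm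
  rw [hre, hre, hB]
  exact norm_inner_le_norm _ _

theorem Matrix.trace_vecMulVec_star_mul {n : Type*} [Fintype n]
    (x : n → ℂ) (A : Matrix n n ℂ) :
    Matrix.trace (Matrix.vecMulVec x (star x) * A) = star x ⬝ᵥ A *ᵥ x := by
  rw [vecMulVec_mul, trace_vecMulVec, dotProduct_comm, dotProduct_mulVec]

/-- **Ambiguous discrimination bound for pure states.** For unit vectors `u, v ∈ ℂ^d` and
any effect `E` with `0 ≤ E ≤ I`,
`tr(|u⟩⟨u| E) + tr(|v⟩⟨v| (I − E)) ≤ 1 + √(1 − |⟨u, v⟩|²)`; hence any binary POVM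
distinguishes the two pure states with probability at most
`(1/2)(1 + √(1 − |⟨u, v⟩|²))`. -/
theorem ambiguous_discrimination_bound {d : ℕ} (u v : Fin d → ℂ)
    (hu : star u ⬝ᵥ u = 1) (hv : star v ⬝ᵥ v = 1)
    (E : Matrix (Fin d) (Fin d) ℂ) (hE : E.PosSemidef) (hE' : (1 - E).PosSemidef) :
    (Matrix.trace (Matrix.vecMulVec u (star u) * E)).re +
        (Matrix.trace (Matrix.vecMulVec v (star v) * (1 - E))).re ≤
      1 + Real.sqrt (1 - ‖star u ⬝ᵥ v‖ ^ 2) := by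
  have hnonneg {A : Matrix (Fin d) (Fin d) ℂ} (hA : A.PosSemidef) (x : Fin d → ℂ) :
      0 ≤ (star x ⬝ᵥ A *ᵥ x).re := hA.re_dotProduct_nonneg x
  have hsplit (x y : Fin d → ℂ) :
      star x ⬝ᵥ E *ᵥ y + star x ⬝ᵥ (1 - E) *ᵥ y = star x ⬝ᵥ y := by
    rw [← dotProduct_add, ← add_mulVec, add_sub_cancel, one_mulVec]
  have hsum {x : Fin d → ℂ} (hx : star x ⬝ᵥ x = 1) :
      √(star x ⬝ᵥ E *ᵥ x).re ^ 2 + √(star x ⬝ᵥ (1 - E) *ᵥ x).re ^ 2 = 1 := by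
    rw [Real.sq_sqrt (hnonneg hE x), Real.sq_sqrt (hnonneg hE' x),
      ← Complex.add_re, hsplit, hx, Complex.one_re]
  have hoverlap := (norm_add_le _ _).trans
    (add_le_add (hE.norm_dotProduct_mulVec_le u v) (hE'.norm_dotProduct_mulVec_le u v))
  rw [hsplit] at hoverlap
  rw [trace_vecMulVec_star_mul, trace_vecMulVec_star_mul,
    ← Real.sq_sqrt (hnonneg hE u), ← Real.sq_sqrt (hnonneg hE' v)]
  have hu' := hsum hu
  have hv' := hsum hv
  generalize √(star u ⬝ᵥ E *ᵥ u).re = p at *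
  generalize √(star v ⬝ᵥ E *ᵥ v).re = q at *
  generalize √(star u ⬝ᵥ (1 - E) *ᵥ u).re = r at *
  generalize √(star v ⬝ᵥ (1 - E) *ᵥ v).re = t at *
  have hsq := pow_le_pow_left₀ (norm_nonneg _) hoverlap 2
  have hdiff : p ^ 2 - q ^ 2 ≤ √(1 - ‖star u ⬝ᵥ v‖ ^ 2) := by
    apply Real.le_sqrt_of_sq_le
    have hr : r ^ 2 = 1 - p ^ 2 := by linarith
    have ht : t ^ 2 = 1 - q ^ 2 := by linarith
    have hid : (p ^ 2 - q ^ 2) ^ 2 + (p * q + r * t) ^ 2 + (p * r - q * t) ^ 2 = 1 := by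
      linear_combination (p ^ 2 + t ^ 2) * hr + (1 - p ^ 2 + q ^ 2) * ht
    linarith [sq_nonneg (p * r - q * t)]
  linarith
end

section
/- Let ρ₁₄, ρ₂₃, ρ₂₄, ρ₃₄ be d×d complex positive semidefinite matrices with trace 1 satisfying the operational equivalence ρ₁₄ + ρ₂₃ = ρ₂₄ + ρ₃₄, and let M(1), M(2), M(3) be d×d positive semidefinite matrices with M(1) + M(2) + M(3) = I. Then tr(ρ₃₄ M(1)) + tr(ρ₂₄ M(2)) + tr(ρ₂₃ M(3)) ≤ 2. -/
open Matrix ComplexOrder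

open scoped MatrixOrder Matrix.Norms.L2Operator in
/-- The trace of a product of two positive semidefinite matrices is nonnegative. -/
theorem Matrix.PosSemidef.re_trace_mul_nonneg {n : Type*} [Fintype n]
    {A B : Matrix n n ℂ} (hA : A.PosSemidef) (hB : B.PosSemidef) :
    0 ≤ (Matrix.trace (A * B)).re := by
  classical
  obtain ⟨C, rfl⟩ := CStarAlgebra.nonneg_iff_eq_star_mul_self.mp hB.nonneg
  rw [star_eq_conjTranspose, ← Matrix.mul_assoc, Matrix.trace_mul_comm, ← Matrix.mul_assoc]
  exact (Complex.le_def.mp (hA.mul_mul_conjTranspose_same C).trace_nonneg).1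

/-- If the density matrices `ρ₁₄, ρ₂₃, ρ₂₄, ρ₃₄` on `ℂ^d` satisfy the operational
equivalence `ρ₁₄ + ρ₂₃ = ρ₂₄ + ρ₃₄` and `(M 1, M 2, M 3)` is a ternary POVM, then
`tr(ρ₃₄ M(1)) + tr(ρ₂₄ M(2)) + tr(ρ₂₃ M(3)) ≤ 2`. -/
theorem T42_operational_equivalence_bound {d : ℕ}
    (ρ14 ρ23 ρ24 ρ34 : Matrix (Fin d) (Fin d) ℂ)
    (h14 : ρ14.PosSemidef) (h23 : ρ23.PosSemidef) (h24 : ρ24.PosSemidef)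
    (h34 : ρ34.PosSemidef)
    (t14 : Matrix.trace ρ14 = 1) (t23 : Matrix.trace ρ23 = 1)
    (t24 : Matrix.trace ρ24 = 1) (t34 : Matrix.trace ρ34 = 1)
    (hop : ρ14 + ρ23 = ρ24 + ρ34)
    (M : Fin 3 → Matrix (Fin d) (Fin d) ℂ)
    (hM : ∀ o, (M o).PosSemidef)
    (hMsum : M 0 + M 1 + M 2 = 1) :
    (Matrix.trace (ρ34 * M 0)).re + (Matrix.trace (ρ24 * M 1)).re +
        (Matrix.trace (ρ23 * M 2)).re ≤ 2 := by
  have h0 := h24.re_trace_mul_nonneg (hM 0)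
  have h1 := h34.re_trace_mul_nonneg (hM 1)
  have h2 := h14.re_trace_mul_nonneg (hM 2)
  have htotal : Matrix.trace ((ρ24 + ρ34) * (M 0 + M 1 + M 2)) = 2 := by
    rw [hMsum, Matrix.mul_one, Matrix.trace_add, t24, t34]
    norm_num
  have hswap : Matrix.trace ((ρ14 + ρ23) * M 2) = Matrix.trace ((ρ24 + ρ34) * M 2) := by
    rw [hop]
  have htotal_re := congrArg Complex.re htotal
  have hswap_re := congrArg Complex.re hswap
  simp only [Matrix.add_mul, Matrix.mul_add, Matrix.trace_add, Complex.add_re,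
    Complex.re_ofNat] at htotal_re hswap_re
  linarith
end

section
/- Let ρ_i, i ∈ I (a nonempty finite index set), be d×d complex positive semidefinite matrices with trace 1, and let (M(j))_{j ∈ J} be a POVM on ℂ^d, i.e., a finite family of d×d positive semidefinite matrices with Σ_j M(j) = I. Then Σ_{j ∈ J} max_{i ∈ I} tr(ρ_i M(j)) ≤ d. In particular, for the communication matrix A with entries A_{ij} = tr(ρ_i M(j)), the ultraweak monotone λ_max(A) = Σ_j max_i A_{ij} is at most the Hilbert space dimension d. -/
open Matrix ComplexOrder

open scoped MatrixOrder in
/-- A positive semidefinite matrix has the form `Xᴴ * X`. -/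
lemma Matrix.PosSemidef.exists_eq_conjTranspose_mul_self {n : Type*} [Fintype n]
    {A : Matrix n n ℂ} (hA : A.PosSemidef) : ∃ X : Matrix n n ℂ, A = Xᴴ * X := by
  classical
  exact CStarAlgebra.nonneg_iff_eq_star_mul_self.mp hA.nonneg

open scoped Matrix.Norms.Frobenius in
/-- The trace of `Aᴴ * A` is the squared Frobenius norm of `A`. -/
lemma Matrix.re_trace_conjTranspose_mul_self {m n : Type*} [Fintype m] [Fintype n]
    (A : Matrix m n ℂ) : (Aᴴ * A).trace.re = ‖A‖ ^ 2 := by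
  rw [frobenius_norm_def, ← Real.sqrt_eq_rpow, Real.sq_sqrt (by positivity), Finset.sum_comm]
  simp [trace, mul_apply, ← Complex.normSq_eq_norm_sq, Complex.normSq_apply]

open scoped Matrix.Norms.Frobenius in
/-- The trace of a product of positive semidefinite matrices is at most the product of the
traces. -/
lemma Matrix.PosSemidef.re_trace_mul_le {n : Type*} [Fintype n] {A B : Matrix n n ℂ}
    (hA : A.PosSemidef) (hB : B.PosSemidef) :
    (A * B).trace.re ≤ A.trace.re * B.trace.re := by
  obtain ⟨X, rfl⟩ := hA.exists_eq_conjTranspose_mul_self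
  obtain ⟨Y, rfl⟩ := hB.exists_eq_conjTranspose_mul_self
  have h : (Xᴴ * X * (Yᴴ * Y)).trace = ((X * Yᴴ)ᴴ * (X * Yᴴ)).trace := by
    rw [← Matrix.mul_assoc, trace_mul_comm, conjTranspose_mul, conjTranspose_conjTranspose]
    simp only [Matrix.mul_assoc]
  rw [h, re_trace_conjTranspose_mul_self, re_trace_conjTranspose_mul_self,
    re_trace_conjTranspose_mul_self, ← mul_pow]
  gcongr
  simpa only [frobenius_norm_conjTranspose] using frobenius_norm_mul X Yᴴ

/-- For density matrices `ρ_i` on `ℂ^d` (over a nonempty finite index set `I`) and a POVM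
`(M j)_{j ∈ J}`, the ultraweak monotone `λ_max` of the communication matrix
`A_{ij} = tr(ρ_i M(j))` satisfies `λ_max(A) = Σ_j max_i tr(ρ_i M(j)) ≤ d`. -/
theorem lambda_max_le_dim {d : ℕ} {I J : Type*} [Fintype I] [Nonempty I] [Fintype J]
    (ρ : I → Matrix (Fin d) (Fin d) ℂ)
    (hρ : ∀ i, (ρ i).PosSemidef) (hρtr : ∀ i, Matrix.trace (ρ i) = 1)
    (M : J → Matrix (Fin d) (Fin d) ℂ)
    (hM : ∀ j, (M j).PosSemidef) (hMsum : ∑ j : J, M j = 1) :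
    ∑ j : J, (Finset.univ.sup' Finset.univ_nonempty
        fun i : I => (Matrix.trace (ρ i * M j)).re) ≤ (d : ℝ) := by
  calc
    _ ≤ ∑ j, (M j).trace.re := Finset.sum_le_sum fun j _ => Finset.sup'_le _ _ fun i _ => by
      simpa [hρtr i] using (hρ i).re_trace_mul_le (hM j)
    _ = d := by rw [← Complex.re_sum, ← trace_sum, hMsum]; simp
end

section
/- For any four unit vectors φ₁, φ₂, φ₃, φ₄ ∈ ℂ² and any six binary POVMs M_{ij} (one for each pair 1 ≤ i < j ≤ 4, each consisting of two 2×2 positive semidefinite matrices M_{ij}(1), M_{ij}(2) summing to the identity), the T_{4,1} success metric Σ_{i<j} [ tr(|φ_i⟩⟨φ_i| M_{ij}(1)) + tr(|φ_j⟩⟨φ_j| M_{ij}(2)) ] is at most 6 + 2√6 ≈ 10.898979. -/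
open Matrix ComplexOrder

/-- The first Bloch coordinate of a qubit vector. -/
noncomputable def blochX (v : Fin 2 → ℂ) : ℝ := Complex.normSq (v 0) - Complex.normSq (v 1)

/-- The second Bloch coordinate of a qubit vector. -/
noncomputable def blochY (v : Fin 2 → ℂ) : ℝ := 2 * (v 0 * star (v 1)).re

/-- The third Bloch coordinate of a qubit vector. -/
noncomputable def blochZ (v : Fin 2 → ℂ) : ℝ := 2 * (v 0 * star (v 1)).im

lemma bloch_sq_of_unit {v : Fin 2 → ℂ} (hv : star v ⬝ᵥ v = 1) :
    blochX v ^ 2 + blochY v ^ 2 + blochZ v ^ 2 = 1 := by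
  have h := normSq_add_normSq_of_unit hv
  have e : blochX v ^ 2 + blochY v ^ 2 + blochZ v ^ 2
      = (Complex.normSq (v 0) + Complex.normSq (v 1)) ^ 2 := by
    simp [blochX, blochY, blochZ, Complex.normSq_apply]
    ring
  rw [e, h, one_pow]

lemma Matrix.PosSemidef.fin_two_entries {A : Matrix (Fin 2) (Fin 2) ℂ} (hA : A.PosSemidef) :
    0 ≤ (A 0 0).re ∧ 0 ≤ (A 1 1).re ∧ (A 0 0).im = 0 ∧ (A 1 1).im = 0 ∧
      A 0 1 = star (A 1 0) ∧
      (A 1 0).re ^ 2 + (A 1 0).im ^ 2 ≤ (A 0 0).re * (A 1 1).re := by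
  have h0 := Complex.le_def.1 (hA.diag_nonneg (i := 0))
  have h1 := Complex.le_def.1 (hA.diag_nonneg (i := 1))
  have hs : A 0 1 = star (A 1 0) := (hA.isHermitian.apply 0 1).symm
  have hd := (Complex.le_def.1 hA.det_nonneg).1
  simp only [Complex.zero_re, Complex.zero_im] at h0 h1
  refine ⟨h0.1, h1.1, h0.2.symm, h1.2.symm, hs, ?_⟩
  rw [Matrix.det_fin_two, hs] at hd
  simp [← h0.2, ← h1.2] at hd
  nlinarith

lemma trace_vecMulVec_mul_re_s15 {v : Fin 2 → ℂ} (hv : star v ⬝ᵥ v = 1)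
    {A : Matrix (Fin 2) (Fin 2) ℂ} (hA : A.PosSemidef) :
    (Matrix.trace (Matrix.vecMulVec v (star v) * A)).re =
      ((A 0 0).re + (A 1 1).re) / 2 + ((A 0 0).re - (A 1 1).re) / 2 * blochX v
        + (A 1 0).re * blochY v - (A 1 0).im * blochZ v := by
  obtain ⟨-, -, h0, h1, hs, -⟩ := hA.fin_two_entries
  have h := normSq_add_normSq_of_unit hv
  simp only [Complex.normSq_apply] at h
  simp [Matrix.trace, Matrix.mul_apply, Matrix.vecMulVec_apply, Fin.sum_univ_two, hs, h0, h1,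
    blochX, blochY, blochZ, Complex.normSq_apply]
  linear_combination ((A 0 0).re + (A 1 1).re) / 2 * h

lemma pair_discrimination_le {v w : Fin 2 → ℂ} (hv : star v ⬝ᵥ v = 1) (hw : star w ⬝ᵥ w = 1)
    {A B : Matrix (Fin 2) (Fin 2) ℂ} (hA : A.PosSemidef) (hB : B.PosSemidef) (hAB : A + B = 1) :
    (Matrix.trace (Matrix.vecMulVec v (star v) * A)).re +
        (Matrix.trace (Matrix.vecMulVec w (star w) * B)).re ≤
      1 + √6 / 6 + √6 / 16 * ((blochX v - blochX w) ^ 2 + (blochY v - blochY w) ^ 2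
        + (blochZ v - blochZ w) ^ 2) := by
  rw [trace_vecMulVec_mul_re_s15 hv hA, trace_vecMulVec_mul_re_s15 hw hB]
  obtain ⟨a0, a1, -, -, -, ha⟩ := hA.fin_two_entries
  obtain ⟨b0, b1, -, -, -, hb⟩ := hB.fin_two_entries
  obtain rfl : B = 1 - A := eq_sub_of_add_eq' hAB
  simp at b0 b1 hb ⊢
  set k := √6
  have k2 : k ^ 2 = 6 := Real.sq_sqrt (by norm_num)
  have k0 : 0 ≤ k := Real.sqrt_nonneg 6
  have tangent : ∀ m d : ℝ, m * d ≤ 2 * k / 3 * m ^ 2 + k / 16 * d ^ 2 := fun m d => by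
    have h := mul_nonneg k0 (sq_nonneg (d - 4 * k / 3 * m))
    linear_combination h / 16 + (k * m ^ 2 / 9 - m * d / 6) * k2
  have hm : (((A 0 0).re - (A 1 1).re) / 2) ^ 2 + (A 1 0).re ^ 2 + (A 1 0).im ^ 2 ≤ 1 / 4 := by
    nlinarith [sq_nonneg ((A 0 0).re + (A 1 1).re - 1)]
  have tX := tangent (((A 0 0).re - (A 1 1).re) / 2) (blochX v - blochX w)
  have tY := tangent (A 1 0).re (blochY v - blochY w)
  have tZ := tangent (-(A 1 0).im) (blochZ v - blochZ w)
  linear_combination tX + tY + tZ + 2 / 3 * mul_le_mul_of_nonneg_left hm k0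

/-- For any four unit vectors `φ₁, …, φ₄ ∈ ℂ²` and any six binary qubit POVMs `M_{ij}`
(one for each pair `i < j`), the `T_{4,1}` success metric
`Σ_{i<j} [tr(|φ_i⟩⟨φ_i| M_{ij}(1)) + tr(|φ_j⟩⟨φ_j| M_{ij}(2))]` is at most `6 + 2√6`. -/
theorem T41_qubit_outer_bound (φ : Fin 4 → Fin 2 → ℂ)
    (hφ : ∀ a, star (φ a) ⬝ᵥ φ a = 1)
    (M : Fin 4 → Fin 4 → Fin 2 → Matrix (Fin 2) (Fin 2) ℂ)
    (hM : ∀ i j, i < j → (M i j 0).PosSemidef ∧ (M i j 1).PosSemidef ∧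
      M i j 0 + M i j 1 = 1) :
    ∑ p ∈ Finset.univ.filter (fun p : Fin 4 × Fin 4 => p.1 < p.2),
        ((Matrix.trace (Matrix.vecMulVec (φ p.1) (star (φ p.1)) * M p.1 p.2 0)).re +
          (Matrix.trace (Matrix.vecMulVec (φ p.2) (star (φ p.2)) * M p.1 p.2 1)).re)
      ≤ 6 + 2 * Real.sqrt 6 := by
  have key := fun i j (hij : i < j) =>
    pair_discrimination_le (hφ i) (hφ j) (hM i j hij).1 (hM i j hij).2.1 (hM i j hij).2.2
  have hb := fun i => bloch_sq_of_unit (hφ i)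
  have hf : Finset.univ.filter (fun p : Fin 4 × Fin 4 => p.1 < p.2) =
      {(0, 1), (0, 2), (0, 3), (1, 2), (1, 3), (2, 3)} := by decide
  rw [hf]
  repeat rw [Finset.sum_insert (by decide)]
  rw [Finset.sum_singleton]
  have k01 := key 0 1 (by decide)
  have k02 := key 0 2 (by decide)
  have k03 := key 0 3 (by decide)
  have k12 := key 1 2 (by decide)
  have k13 := key 1 3 (by decide)
  have k23 := key 2 3 (by decide)
  have h := mul_nonneg (Real.sqrt_nonneg 6)
    (add_nonneg (add_nonneg (sq_nonneg (∑ i, blochX (φ i))) (sq_nonneg (∑ i, blochY (φ i))))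
      (sq_nonneg (∑ i, blochZ (φ i))))
  simp only [Fin.sum_univ_four] at h
  linear_combination k01 + k02 + k03 + k12 + k13 + k23 + h / 16
    + √6 / 4 * (hb 0 + hb 1 + hb 2 + hb 3)
end

section
/- For any four unit vectors φ₁, φ₂, φ₃, φ₄ ∈ ℂ³ and any six binary POVMs M_{ij} (one for each pair 1 ≤ i < j ≤ 4, each consisting of two 3×3 positive semidefinite matrices M_{ij}(1), M_{ij}(2) summing to the identity), the T_{4,1} success metric Σ_{i<j} [ tr(|φ_i⟩⟨φ_i| M_{ij}(1)) + tr(|φ_j⟩⟨φ_j| M_{ij}(2)) ] is at most 6 + 4√2 ≈ 11.656854. -/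
open Matrix ComplexOrder

/-- The trace of `B * Bᴴ` is the squared Frobenius norm of `B`. -/
theorem trace_mul_conjTranspose_eq_sum_norm_sq {m n : Type*} [Fintype m] [Fintype n]
    (B : Matrix m n ℂ) : (B * Bᴴ).trace = ((∑ i, ∑ j, ‖B i j‖ ^ 2 : ℝ) : ℂ) := by
  simp [Matrix.trace, Matrix.mul_apply, Complex.mul_conj']

/-- **Welch bound** for the first moment: the Gram matrix of a finite family of unit vectors in
`ℂ^n` has squared Frobenius norm at least `(number of vectors)² / n`. -/
theorem card_sq_le_card_mul_sum_norm_dotProduct_sq {ι n : Type*} [Fintype ι] [Fintype n]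
    (φ : ι → n → ℂ) (hφ : ∀ a, star (φ a) ⬝ᵥ φ a = 1) :
    (Fintype.card ι : ℝ) ^ 2 ≤
      Fintype.card n * ∑ i, ∑ j, ‖star (φ i) ⬝ᵥ φ j‖ ^ 2 := by
  let A : Matrix ι n ℂ := Matrix.of fun i k => star (φ i k)
  have hA : ∀ i j, (A * Aᴴ) i j = star (φ i) ⬝ᵥ φ j := by
    intro i j
    simp [A, Matrix.mul_apply, dotProduct]
  have htr : (Aᴴ * A).trace = Fintype.card ι := by
    rw [Matrix.trace_mul_comm]
    simp [Matrix.trace, hA, hφ]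
  have hswap : ∑ k, ∑ l, ‖(Aᴴ * A) k l‖ ^ 2 = ∑ i, ∑ j, ‖(A * Aᴴ) i j‖ ^ 2 := by
    have h : ((Aᴴ * A) * (Aᴴ * A)ᴴ).trace = ((A * Aᴴ) * (A * Aᴴ)ᴴ).trace := by
      simp only [Matrix.conjTranspose_mul, Matrix.conjTranspose_conjTranspose]
      rw [Matrix.mul_assoc, Matrix.trace_mul_comm]
      simp only [Matrix.mul_assoc]
    rw [trace_mul_conjTranspose_eq_sum_norm_sq, trace_mul_conjTranspose_eq_sum_norm_sq] at h
    exact_mod_cast h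
  simp only [← hA]
  rw [← hswap]
  have h1 : (Fintype.card ι : ℝ) ≤ ∑ k, ‖(Aᴴ * A) k k‖ := by
    calc (Fintype.card ι : ℝ) = ‖(Aᴴ * A).trace‖ := by rw [htr]; simp
      _ ≤ _ := norm_sum_le _ _
  calc (Fintype.card ι : ℝ) ^ 2 ≤ (∑ k, ‖(Aᴴ * A) k k‖) ^ 2 := by gcongr
    _ ≤ Fintype.card n * ∑ k, ‖(Aᴴ * A) k k‖ ^ 2 := sq_sum_le_card_mul_sum_sq
    _ ≤ _ := by
      gcongr with k
      exact Finset.single_le_sum (f := fun l => ‖(Aᴴ * A) k l‖ ^ 2)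
        (fun _ _ => by positivity) (Finset.mem_univ k)

open scoped MatrixOrder Matrix.Norms.L2Operator in
/-- Squared form of the Helstrom bound: the bias with which a binary POVM discriminates two unit
vectors is limited by their overlap. -/
theorem helstrom_sq_add_sq_le_one {n : Type*} [Fintype n] [DecidableEq n] {u v : n → ℂ}
    (hu : star u ⬝ᵥ u = 1) (hv : star v ⬝ᵥ v = 1) {E F : Matrix n n ℂ}
    (hE : E.PosSemidef) (hF : F.PosSemidef) (hEF : E + F = 1) :
    ((Matrix.trace (Matrix.vecMulVec u (star u) * E)).re +
      (Matrix.trace (Matrix.vecMulVec v (star v) * F)).re - 1) ^ 2 +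
      ‖star u ⬝ᵥ v‖ ^ 2 ≤ 1 := by
  obtain ⟨B, rfl⟩ := CStarAlgebra.nonneg_iff_eq_star_mul_self.mp hE.nonneg
  obtain ⟨C, rfl⟩ := CStarAlgebra.nonneg_iff_eq_star_mul_self.mp hF.nonneg
  simp only [star_eq_conjTranspose] at *
  have hinner : ∀ (D : Matrix n n ℂ) (x y : n → ℂ), star x ⬝ᵥ ((Dᴴ * D) *ᵥ y) =
      inner ℂ (WithLp.toLp 2 (D *ᵥ x)) (WithLp.toLp 2 (D *ᵥ y)) := by
    intro D x y
    rw [EuclideanSpace.inner_toLp_toLp, star_mulVec, ← mulVec_mulVec, dotProduct_mulVec (star x),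
      dotProduct_comm]
  have hsq : ∀ (D : Matrix n n ℂ) (x : n → ℂ), star x ⬝ᵥ ((Dᴴ * D) *ᵥ x) =
      ((‖WithLp.toLp 2 (D *ᵥ x)‖ ^ 2 : ℝ) : ℂ) := by
    intro D x
    rw [hinner, inner_self_eq_norm_sq_to_K]
    simp
  have htr : ∀ (D : Matrix n n ℂ) (x : n → ℂ),
      (Matrix.trace (Matrix.vecMulVec x (star x) * (Dᴴ * D))).re =
        ‖WithLp.toLp 2 (D *ᵥ x)‖ ^ 2 := by
    intro D x
    rw [Matrix.vecMulVec_mul, Matrix.trace_vecMulVec, dotProduct_comm, ← dotProduct_mulVec, hsq,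
      Complex.ofReal_re]
  have hsplit : ∀ x y : n → ℂ, star x ⬝ᵥ y =
      star x ⬝ᵥ ((Bᴴ * B) *ᵥ y) + star x ⬝ᵥ ((Cᴴ * C) *ᵥ y) := by
    intro x y
    rw [← dotProduct_add, ← add_mulVec, hEF, one_mulVec]
  have hunit : ∀ x : n → ℂ, star x ⬝ᵥ x = 1 →
      ‖WithLp.toLp 2 (B *ᵥ x)‖ ^ 2 + ‖WithLp.toLp 2 (C *ᵥ x)‖ ^ 2 = 1 := by
    intro x hx
    rw [hsplit, hsq, hsq] at hx
    exact_mod_cast hx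
  have hc : ‖star u ⬝ᵥ v‖ ≤ ‖WithLp.toLp 2 (B *ᵥ u)‖ * ‖WithLp.toLp 2 (B *ᵥ v)‖ +
      ‖WithLp.toLp 2 (C *ᵥ u)‖ * ‖WithLp.toLp 2 (C *ᵥ v)‖ := by
    rw [hsplit, hinner, hinner]
    exact (norm_add_le _ _).trans <|
      add_le_add (norm_inner_le_norm _ _) (norm_inner_le_norm _ _)
  have h1 := hunit u hu
  have h2 := hunit v hv
  rw [htr, htr]
  have h3 := pow_le_pow_left₀ (norm_nonneg _) hc 2
  generalize ‖WithLp.toLp 2 (B *ᵥ u)‖ = p at *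
  generalize ‖WithLp.toLp 2 (B *ᵥ v)‖ = r at *
  generalize ‖WithLp.toLp 2 (C *ᵥ u)‖ = q at *
  generalize ‖WithLp.toLp 2 (C *ᵥ v)‖ = t at *
  have hq : q ^ 2 = 1 - p ^ 2 := by linarith
  have ht : t ^ 2 = 1 - r ^ 2 := by linarith
  have h4 : (p * r + q * t) ^ 2 + (p ^ 2 - r ^ 2) ^ 2 + (p * q - r * t) ^ 2 = 1 := by
    have : (p * r + q * t) ^ 2 + (p ^ 2 - r ^ 2) ^ 2 + (p * q - r * t) ^ 2 =
        p ^ 2 * r ^ 2 + q ^ 2 * t ^ 2 + (p ^ 2 - r ^ 2) ^ 2 + p ^ 2 * q ^ 2 + r ^ 2 * t ^ 2 := by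
      ring
    rw [this, hq, ht]
    ring
  have h5 : p ^ 2 + t ^ 2 - 1 = p ^ 2 - r ^ 2 := by linarith
  rw [h5]
  linarith [sq_nonneg (p * q - r * t)]

/-- For any four unit vectors `φ₁, …, φ₄ ∈ ℂ³` and any six binary qutrit POVMs `M_{ij}`
(one for each pair `i < j`), the `T_{4,1}` success metric
`Σ_{i<j} [tr(|φ_i⟩⟨φ_i| M_{ij}(1)) + tr(|φ_j⟩⟨φ_j| M_{ij}(2))]` is at most `6 + 4√2`. -/
theorem T41_qutrit_outer_bound (φ : Fin 4 → Fin 3 → ℂ)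
    (hφ : ∀ a, star (φ a) ⬝ᵥ φ a = 1)
    (M : Fin 4 → Fin 4 → Fin 2 → Matrix (Fin 3) (Fin 3) ℂ)
    (hM : ∀ i j, i < j → (M i j 0).PosSemidef ∧ (M i j 1).PosSemidef ∧
      M i j 0 + M i j 1 = 1) :
    ∑ p ∈ Finset.univ.filter (fun p : Fin 4 × Fin 4 => p.1 < p.2),
        ((Matrix.trace (Matrix.vecMulVec (φ p.1) (star (φ p.1)) * M p.1 p.2 0)).re +
          (Matrix.trace (Matrix.vecMulVec (φ p.2) (star (φ p.2)) * M p.1 p.2 1)).re)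
      ≤ 6 + 4 * Real.sqrt 2 := by
  have hs : Real.sqrt 2 ^ 2 = 2 := Real.sq_sqrt (by norm_num)
  have hs0 : 0 < Real.sqrt 2 := by positivity
  have hpair : ∀ p ∈ Finset.univ.filter (fun p : Fin 4 × Fin 4 => p.1 < p.2),
      (Matrix.trace (Matrix.vecMulVec (φ p.1) (star (φ p.1)) * M p.1 p.2 0)).re +
          (Matrix.trace (Matrix.vecMulVec (φ p.2) (star (φ p.2)) * M p.1 p.2 1)).re ≤
        1 + 3 * Real.sqrt 2 / 8 * (17 / 9 - ‖star (φ p.1) ⬝ᵥ φ p.2‖ ^ 2) := by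
    intro p hp
    obtain ⟨h0, h1, h01⟩ := hM p.1 p.2 (Finset.mem_filter.mp hp).2
    have h := helstrom_sq_add_sq_le_one (hφ p.1) (hφ p.2) h0 h1 h01
    generalize (Matrix.trace (Matrix.vecMulVec (φ p.1) (star (φ p.1)) * M p.1 p.2 0)).re +
      (Matrix.trace (Matrix.vecMulVec (φ p.2) (star (φ p.2)) * M p.1 p.2 1)).re = x at *
    have h2 := mul_nonneg hs0.le (sq_nonneg (x - 1 - 2 * Real.sqrt 2 / 3))
    have h3 := mul_le_mul_of_nonneg_left h hs0.le
    have h4 : Real.sqrt 2 ^ 3 = 2 * Real.sqrt 2 := by rw [pow_succ, hs]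
    nlinarith
  have hwelch := card_sq_le_card_mul_sum_norm_dotProduct_sq φ hφ
  have hsymm : ∀ i j, ‖star (φ i) ⬝ᵥ φ j‖ = ‖star (φ j) ⬝ᵥ φ i‖ := by
    intro i j
    rw [← norm_star, ← star_dotProduct]
  have hoverlap : 2 / 3 ≤ ∑ p ∈ Finset.univ.filter (fun p : Fin 4 × Fin 4 => p.1 < p.2),
      ‖star (φ p.1) ⬝ᵥ φ p.2‖ ^ 2 := by
    rw [Finset.sum_filter, Fintype.sum_prod_type]
    simp only [Fin.sum_univ_four, hφ, Fintype.card_fin] at hwelch ⊢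
    simp only [hsymm 1 0, hsymm 2 0, hsymm 3 0, hsymm 2 1, hsymm 3 1, hsymm 3 2] at hwelch
    simp only [norm_one] at hwelch
    simp (decide := true) only [if_true, if_false]
    push_cast at hwelch
    linarith
  have hcard : (Finset.univ.filter (fun p : Fin 4 × Fin 4 => p.1 < p.2)).card = 6 := by decide
  refine (Finset.sum_le_sum hpair).trans ?_
  rw [Finset.sum_add_distrib, ← Finset.mul_sum, Finset.sum_sub_distrib]
  simp only [Finset.sum_const, hcard, nsmul_eq_mul]
  push_cast
  nlinarith [mul_le_mul_of_nonneg_left hoverlap hs0.le]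
end

section
/- There exist six 3×3 complex positive semidefinite matrices ρ₁₂, ρ₁₃, ρ₁₄, ρ₂₃, ρ₂₄, ρ₃₄ with trace 1 (qutrit states) and four POVMs (M_k(l))_{l ∈ {1,2,3,4}\{k}} on ℂ³ for k ∈ {1,2,3,4} (each a triple of 3×3 positive semidefinite matrices summing to the identity) such that tr(ρ_{mn} M_k(l)) = 1 for every k and every l ≠ k, where {m, n} = {1,2,3,4} \ {k, l}. Hence the T_{4,2} success metric attains its maximal value 12 with qutrits. -/
open Matrix ComplexOrder

/-- The coordinate `i : Fin 3` labels the perfect matching of `Fin 4` having `{0, i + 1}` as an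
edge; this says that `s` is one of the two edges of that matching. -/
abbrev IsMatchingEdge (s : Finset (Fin 4)) (i : Fin 3) : Prop :=
  s = {0, i.succ} ∨ sᶜ = {0, i.succ}

/-- The projection onto the basis vectors whose matching contains the edge `s`. -/
def matchingProj (s : Finset (Fin 4)) : Matrix (Fin 3) (Fin 3) ℂ :=
  diagonal fun i => if IsMatchingEdge s i then 1 else 0

lemma posSemidef_matchingProj (s : Finset (Fin 4)) : (matchingProj s).PosSemidef := by
  refine PosSemidef.diagonal fun i => ?_
  dsimp only [Pi.zero_apply]
  split_ifs <;> simp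

lemma exists_isMatchingEdge_iff :
    ∀ s : Finset (Fin 4), s.card = 2 → ∃ i, ∀ j, IsMatchingEdge s j ↔ j = i := by
  decide

lemma trace_matchingProj {s : Finset (Fin 4)} (hs : s.card = 2) :
    (matchingProj s).trace = 1 := by
  obtain ⟨i, hi⟩ := exists_isMatchingEdge_iff s hs
  simp only [matchingProj, hi, trace_diagonal, Finset.sum_ite_eq',
    Finset.mem_univ, if_true]

lemma matchingProj_compl (s : Finset (Fin 4)) : matchingProj sᶜ = matchingProj s := by
  simp only [matchingProj, IsMatchingEdge, compl_compl, or_comm]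

lemma matchingProj_mul_self (s : Finset (Fin 4)) :
    matchingProj s * matchingProj s = matchingProj s := by
  simp [matchingProj, diagonal_mul_diagonal]

lemma exists_isMatchingEdge_pair_iff :
    ∀ (k : Fin 4) (i : Fin 3), ∃ l ∈ Finset.univ.erase k,
      ∀ m ∈ Finset.univ.erase k, IsMatchingEdge {k, m} i ↔ m = l := by
  decide

lemma sum_matchingProj_pair (k : Fin 4) :
    ∑ l ∈ Finset.univ.erase k, matchingProj {k, l} = 1 := by
  ext i j
  rw [Matrix.sum_apply]
  by_cases hij : i = j
  · subst hij
    obtain ⟨l, hl, h⟩ := exists_isMatchingEdge_pair_iff k i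
    rw [one_apply_eq, Finset.sum_eq_single_of_mem l hl]
    · simp only [matchingProj, diagonal_apply_eq, (h l hl).2 rfl, if_true]
    · intro m hm hml
      simp only [matchingProj, diagonal_apply_eq, h m hm, hml, if_false]
  · simp [matchingProj, hij]

/-- There exist qutrit states `ρ_{ij}` (here `σ s` for the 2-element subsets `s ⊆ Fin 4`)
and, for each `k`, a POVM `(M k l)_{l ≠ k}` on `ℂ³`, such that `tr(ρ_{mn} M_k(l)) = 1` for
every `k` and every `l ≠ k`, where `{m, n}` is the complement of `{k, l}` in `Fin 4`.
Hence the `T_{4,2}` success metric attains its maximal value `12` with qutrits. -/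
theorem T42_qutrit_perfect_strategy :
    ∃ (σ : Finset (Fin 4) → Matrix (Fin 3) (Fin 3) ℂ)
      (M : Fin 4 → Fin 4 → Matrix (Fin 3) (Fin 3) ℂ),
      (∀ s : Finset (Fin 4), s.card = 2 → (σ s).PosSemidef) ∧
      (∀ s : Finset (Fin 4), s.card = 2 → Matrix.trace (σ s) = 1) ∧
      (∀ k l, l ≠ k → (M k l).PosSemidef) ∧
      (∀ k, ∑ l ∈ Finset.univ.erase k, M k l = 1) ∧
      (∀ k l, l ≠ k → Matrix.trace (σ (({k, l} : Finset (Fin 4))ᶜ) * M k l) = 1) := by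
  refine ⟨matchingProj, fun k l => matchingProj {k, l}, fun s _ => posSemidef_matchingProj s,
    fun s hs => trace_matchingProj hs, fun k l _ => posSemidef_matchingProj _,
    sum_matchingProj_pair, fun k l hkl => ?_⟩
  rw [matchingProj_compl, matchingProj_mul_self]
  exact trace_matchingProj (Finset.card_pair hkl.symm)
end

section
/- There exist four 2×2 complex positive semidefinite matrices ρ₁, ρ₂, ρ₃, ρ₄ with trace 1 satisfying the operational equivalence ρ₁ + ρ₂ = ρ₃ + ρ₄, and six binary POVMs M_{ij} on ℂ² (one for each pair 1 ≤ i < j ≤ 4, each a pair of positive semidefinite matrices M_{ij}(1), M_{ij}(2) summing to the identity), such that the T_{4,1} success metric Σ_{1≤i<j≤4} tr((ρ_j − ρ_i) M_{ij}(1)) equals 2 + 2√2 ≈ 4.828427. In particular, this quantum value strictly exceeds 4, the maximal value attainable by any preparation-noncontextual ontological model respecting the same operational equivalence. -/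
open Matrix ComplexOrder

/-- The qubit operator with Bloch vector `(x, 0, z)`. -/
noncomputable def blochMatrix (x z : ℝ) : Matrix (Fin 2) (Fin 2) ℂ :=
  !![(((1 + z) / 2 : ℝ) : ℂ), ((x / 2 : ℝ) : ℂ); ((x / 2 : ℝ) : ℂ), (((1 - z) / 2 : ℝ) : ℂ)]

lemma blochMatrix_posSemidef {x z : ℝ} (h : x ^ 2 + z ^ 2 = 1) :
    (blochMatrix x z).PosSemidef := by
  have hB : blochMatrix x z = blochMatrix x z * (blochMatrix x z)ᴴ := by
    ext i j
    fin_cases i <;> fin_cases j <;>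
      simp only [blochMatrix, Matrix.mul_apply, Fin.sum_univ_two, conjTranspose_apply,
        Complex.star_def, Matrix.of_apply, Matrix.cons_val', Matrix.cons_val_zero,
        Matrix.cons_val_one, Matrix.cons_val_fin_one, Fin.zero_eta, Fin.mk_one,
        Complex.conj_ofReal] <;>
      norm_cast <;> linarith
  rw [hB]
  exact posSemidef_self_mul_conjTranspose _

lemma trace_blochMatrix (x z : ℝ) : (blochMatrix x z).trace = 1 := by
  rw [blochMatrix, trace_fin_two_of]
  norm_cast
  ring

lemma blochMatrix_add_neg (x z : ℝ) : blochMatrix x z + blochMatrix (-x) (-z) = 1 := by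
  ext i j
  fin_cases i <;> fin_cases j <;> simp [blochMatrix] <;> ring

lemma trace_blochMatrix_sub_mul (x₁ z₁ x₂ z₂ a b : ℝ) :
    (((blochMatrix x₂ z₂ - blochMatrix x₁ z₁) * blochMatrix a b).trace).re =
      ((x₂ - x₁) * a + (z₂ - z₁) * b) / 2 := by
  simp [blochMatrix, trace_fin_two]
  ring

/-- The measurement along the unit vector in the direction of `(x, z)`; outcome `0` is aligned. -/
noncomputable def blochMeasurement (x z : ℝ) : Fin 2 → Matrix (Fin 2) (Fin 2) ℂ :=
  ![blochMatrix (x / √(x ^ 2 + z ^ 2)) (z / √(x ^ 2 + z ^ 2)),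
    blochMatrix (-(x / √(x ^ 2 + z ^ 2))) (-(z / √(x ^ 2 + z ^ 2)))]

lemma blochMeasurement_isPOVM {x z : ℝ} (h : 0 < x ^ 2 + z ^ 2) :
    (blochMeasurement x z 0).PosSemidef ∧ (blochMeasurement x z 1).PosSemidef ∧
      blochMeasurement x z 0 + blochMeasurement x z 1 = 1 := by
  have hn : (x / √(x ^ 2 + z ^ 2)) ^ 2 + (z / √(x ^ 2 + z ^ 2)) ^ 2 = 1 := by
    rw [div_pow, div_pow, Real.sq_sqrt h.le, ← add_div, div_self h.ne']
  exact ⟨blochMatrix_posSemidef hn,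
    blochMatrix_posSemidef (by rwa [neg_sq, neg_sq]), blochMatrix_add_neg _ _⟩

lemma trace_blochMatrix_sub_mul_blochMeasurement (x₁ z₁ x₂ z₂ : ℝ) :
    (((blochMatrix x₂ z₂ - blochMatrix x₁ z₁) *
      blochMeasurement (x₂ - x₁) (z₂ - z₁) 0).trace).re =
      √((x₂ - x₁) ^ 2 + (z₂ - z₁) ^ 2) / 2 := by
  have h := trace_blochMatrix_sub_mul x₁ z₁ x₂ z₂
    ((x₂ - x₁) / √((x₂ - x₁) ^ 2 + (z₂ - z₁) ^ 2)) ((z₂ - z₁) / √((x₂ - x₁) ^ 2 + (z₂ - z₁) ^ 2))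
  rw [← mul_div_assoc, ← mul_div_assoc, ← add_div, ← pow_two, ← pow_two, Real.div_sqrt] at h
  exact h

/-- There exist four qubit states `ρ₁, ρ₂, ρ₃, ρ₄` satisfying the operational equivalence
`ρ₁ + ρ₂ = ρ₃ + ρ₄` and six binary qubit POVMs `M_{ij}` (one for each pair `i < j`) such
that the constrained `T_{4,1}` success metric `Σ_{i<j} tr((ρ_j − ρ_i) M_{ij}(1))` equals
`2 + 2√2 ≈ 4.828427`; in particular it strictly exceeds the noncontextual bound `4`. -/
theorem T41_contextual_quantum_value :
    ∃ (ρ : Fin 4 → Matrix (Fin 2) (Fin 2) ℂ)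
      (M : Fin 4 → Fin 4 → Fin 2 → Matrix (Fin 2) (Fin 2) ℂ),
      (∀ i, (ρ i).PosSemidef) ∧
      (∀ i, Matrix.trace (ρ i) = 1) ∧
      ρ 0 + ρ 1 = ρ 2 + ρ 3 ∧
      (∀ i j, i < j → (M i j 0).PosSemidef ∧ (M i j 1).PosSemidef ∧
        M i j 0 + M i j 1 = 1) ∧
      ∑ p ∈ Finset.univ.filter (fun p : Fin 4 × Fin 4 => p.1 < p.2),
          (Matrix.trace ((ρ p.2 - ρ p.1) * M p.1 p.2 0)).re = 2 + 2 * Real.sqrt 2 := by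
  set x : Fin 4 → ℝ := ![0, 0, 1, -1] with hx
  set z : Fin 4 → ℝ := ![1, -1, 0, 0] with hz
  refine ⟨fun i => blochMatrix (x i) (z i),
    fun i j => blochMeasurement (x j - x i) (z j - z i), fun i => blochMatrix_posSemidef ?_,
    fun i => trace_blochMatrix _ _, ?_, fun i j hij => blochMeasurement_isPOVM ?_, ?_⟩
  · fin_cases i <;> simp [hx, hz]
  · have h₁ := blochMatrix_add_neg 0 1
    have h₂ := blochMatrix_add_neg 1 0
    rw [neg_zero] at h₁ h₂
    exact h₁.trans h₂.symm
  · fin_cases i <;> fin_cases j <;> first | (norm_num [hx, hz]; done) | simp at hij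
  · have h₄ : √(4 : ℝ) = 2 := by rw [Real.sqrt_eq_iff_mul_self_eq] <;> norm_num
    simp only [trace_blochMatrix_sub_mul_blochMeasurement]
    have hpairs : Finset.univ.filter (fun p : Fin 4 × Fin 4 => p.1 < p.2) =
        {(0, 1), (0, 2), (0, 3), (1, 2), (1, 3), (2, 3)} := by decide
    have hx₂ : x 2 = 1 := rfl
    have hx₃ : x 3 = -1 := rfl
    have hz₂ : z 2 = 0 := rfl
    have hz₃ : z 3 = 0 := rfl
    have hx₀ : x 0 = 0 := rfl
    have hx₁ : x 1 = 0 := rfl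
    have hz₀ : z 0 = 1 := rfl
    have hz₁ : z 1 = -1 := rfl
    rw [hpairs]
    repeat rw [Finset.sum_insert (by decide)]
    rw [Finset.sum_singleton]
    norm_num [hx₀, hx₁, hx₂, hx₃, hz₀, hz₁, hz₂, hz₃, h₄]
    ring
end

section
/- Let Λ be a nonempty finite set, let μ₁, μ₂, μ₃, μ₄ : Λ → ℝ be nonnegative functions with Σ_{λ∈Λ} μ_i(λ) = 1 for each i, satisfying the noncontextuality constraint μ₁(λ) + μ₂(λ) = μ₃(λ) + μ₄(λ) for every λ ∈ Λ, and for each pair 1 ≤ i < j ≤ 4 let ξ_{ij} : Λ → [0,1] be an arbitrary response function. Then Σ_{1≤i<j≤4} Σ_{λ∈Λ} (μ_j(λ) − μ_i(λ)) ξ_{ij}(λ) ≤ 4. Hence every preparation-noncontextual ontological model respecting the operational equivalence P₁ + P₂ ≃ P₃ + P₄ achieves a T_{4,1} success metric of at most 4. -/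
/-- Summing `max (y - x) 0` over the ordered pairs of four nonnegative reals with
`a + b = c + d` is bounded by an affine function whose coefficients sum to `4`. -/
lemma sum_posPart_sub_le {a b c d : ℝ} (ha : 0 ≤ a) (hb : 0 ≤ b) (hc : 0 ≤ c) (hd : 0 ≤ d)
    (h : a + b = c + d) :
    max (b - a) 0 + max (c - a) 0 + max (d - a) 0 + max (c - b) 0 + max (d - b) 0 +
      max (d - c) 0 ≤ (a + b + c + d) + (-3 * a - b + c + 3 * d) / 2 := by
  rcases le_total a b with h₁ | h₁ <;> rcases le_total a c with h₂ | h₂ <;>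
  rcases le_total a d with h₃ | h₃ <;> rcases le_total b c with h₄ | h₄ <;>
  rcases le_total b d with h₅ | h₅ <;> rcases le_total c d with h₆ | h₆ <;>
  simp only [sub_nonneg, sub_nonpos, max_eq_left, max_eq_right, h₁, h₂, h₃, h₄, h₅, h₆] <;>
  linarith

lemma mul_le_max_zero {x t : ℝ} (ht : 0 ≤ t ∧ t ≤ 1) : x * t ≤ max x 0 :=
  (mul_le_mul_of_nonneg_right (le_max_left x 0) ht.1).trans
    (mul_le_of_le_one_right (le_max_right x 0) ht.2)

/-- **Noncontextual bound for the constrained task `T_{4,1}`.** For any nonempty finite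
ontic state space `Λ`, probability distributions `μ₁, μ₂, μ₃, μ₄` on `Λ` satisfying the
preparation-noncontextuality constraint `μ₁(λ) + μ₂(λ) = μ₃(λ) + μ₄(λ)` pointwise, and
arbitrary response functions `ξ_{ij} : Λ → [0,1]` for the pairs `i < j`, the `T_{4,1}`
success metric `Σ_{i<j} Σ_λ (μ_j(λ) − μ_i(λ)) ξ_{ij}(λ)` is at most `4`. -/
theorem T41_noncontextual_bound {Λ : Type*} [Fintype Λ] [Nonempty Λ]
    (μ : Fin 4 → Λ → ℝ)
    (hμnn : ∀ i l, 0 ≤ μ i l)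
    (hμsum : ∀ i, ∑ l : Λ, μ i l = 1)
    (hop : ∀ l, μ 0 l + μ 1 l = μ 2 l + μ 3 l)
    (ξ : Fin 4 → Fin 4 → Λ → ℝ)
    (hξ : ∀ i j l, 0 ≤ ξ i j l ∧ ξ i j l ≤ 1) :
    ∑ p ∈ Finset.univ.filter (fun p : Fin 4 × Fin 4 => p.1 < p.2),
        ∑ l : Λ, (μ p.2 l - μ p.1 l) * ξ p.1 p.2 l ≤ 4 := by
  have hpairs : Finset.univ.filter (fun p : Fin 4 × Fin 4 => p.1 < p.2) =
      {(0, 1), (0, 2), (0, 3), (1, 2), (1, 3), (2, 3)} := by decide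
  rw [Finset.sum_comm]
  calc
    _ ≤ ∑ l : Λ, ((μ 0 l + μ 1 l + μ 2 l + μ 3 l) +
          (-3 * μ 0 l - μ 1 l + μ 2 l + 3 * μ 3 l) / 2) := by
      refine Finset.sum_le_sum fun l _ => le_trans ?_ (sum_posPart_sub_le (hμnn 0 l) (hμnn 1 l)
        (hμnn 2 l) (hμnn 3 l) (hop l))
      refine (Finset.sum_le_sum fun p _ => mul_le_max_zero (hξ p.1 p.2 l)).trans_eq ?_
      rw [hpairs]
      simp [add_assoc]
    _ = 4 := by
      simp only [Finset.sum_add_distrib, Finset.sum_sub_distrib, ← Finset.sum_div,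
        ← Finset.mul_sum, hμsum]
      norm_num
end
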